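/- Let S be a pseudo-nilpotent finite semigroup. Every stem S^{(i)} is connected as a subgraph of the upper non-nilpotent graph N_S, and any two distinct elements of a stem are connected by a path of length at most 2. Consequently, if the largest nilpotent ideal K of S is empty, then S equals a single stem, N_S is connected, and any two distinct vertices are joined by a path of length at most 2. -/

import Mathlib

/-- One multiplication step `a · w · b` where `w` ranges over `S¹`
(`none` playing the role of the adjoined identity). -/
def mulW {S : Type*} [Semigroup S] (a : S) (w : Option S) (b : S) : S :=
  match w with
  | none => a * b
  | some c => a * c * b

/-- The Mal'cev sequences: `(malcev x y w n).1 = λ_n` and `(malcev x y w n).2 = ρ_n`,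
with `λ_0 = x`, `ρ_0 = y`, `λ_{n+1} = λ_n w_{n+1} ρ_n`, `ρ_{n+1} = ρ_n w_{n+1} λ_n`. -/
def malcev {S : Type*} [Semigroup S] (x y : S) (w : ℕ → Option S) : ℕ → S × S
  | 0 => (x, y)
  | n + 1 =>
      let p := malcev x y w n
      (mulW p.1 (w n) p.2, mulW p.2 (w n) p.1)

/-- Mal'cev nilpotency of a (multiplicatively closed) subset `A` of `S`,
computed with parameters from `A¹`. -/
def SetMN {S : Type*} [Semigroup S] (A : Set S) : Prop :=
  ∃ n : ℕ, 0 < n ∧ ∀ x ∈ A, ∀ y ∈ A, ∀ w : ℕ → Option S,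
    (∀ k c, w k = some c → c ∈ A) →
    (malcev x y w n).1 = (malcev x y w n).2

/-- A semigroup is Mal'cev nilpotent. -/
def IsMN (S : Type*) [Semigroup S] : Prop := SetMN (Set.univ : Set S)

/-- Equality in the Rees quotient by (the possibly empty ideal) `I`. -/
def ReesEq {S : Type*} [Semigroup S] (I : Set S) (a b : S) : Prop :=
  a = b ∨ (a ∈ I ∧ b ∈ I)

/-- Mal'cev nilpotency of the Rees quotient `A / I` (computed by lifting to `A`). -/
def SetMNMod {S : Type*} [Semigroup S] (I A : Set S) : Prop :=
  ∃ n : ℕ, 0 < n ∧ ∀ x ∈ A, ∀ y ∈ A, ∀ w : ℕ → Option S,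
    (∀ k c, w k = some c → c ∈ A) →
    ReesEq I (malcev x y w n).1 (malcev x y w n).2

/-- `I` is an ideal of (the mul-closed subset) `T`; the empty set counts as an ideal. -/
def IsIdealIn {S : Type*} [Semigroup S] (T I : Set S) : Prop :=
  I ⊆ T ∧ ∀ a ∈ I, ∀ t ∈ T, t * a ∈ I ∧ a * t ∈ I

/-- Edge of the upper non-nilpotent graph `N_S`: `⟨a,b⟩` is not Mal'cev nilpotent. -/
def NEdge {S : Type*} [Semigroup S] (a b : S) : Prop :=
  a ≠ b ∧ ¬ SetMN (Subsemigroup.closure ({a, b} : Set S) : Set S)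

/-- The generating set of the subsemigroup `⟨x, y, w_1, …, w_m⟩`. -/
def genSet {S : Type*} [Semigroup S] (x y : S) (w : ℕ → Option S) (m : ℕ) : Set S :=
  {x, y} ∪ {c | ∃ k, k < m ∧ w k = some c}

/-- A pseudo-nilpotent semigroup. -/
def IsPN (S : Type*) [Semigroup S] : Prop :=
  ∀ (x y : S) (w : ℕ → Option S) (m : ℕ) (I : Set S),
    IsIdealIn (Subsemigroup.closure (genSet x y w m) : Set S) I →
    (malcev x y w m).1 ∉ I → (malcev x y w m).2 ∉ I →
    (∃ t, t < m ∧ (malcev x y w t).1 ≠ (malcev x y w t).2 ∧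
      malcev x y w t = malcev x y w m) →
    ∀ i ≤ m, ¬ SetMNMod I
      (Subsemigroup.closure ({(malcev x y w i).1, (malcev x y w i).2} : Set S) : Set S)

/-- A principal series `S = S_1 ⊃ S_2 ⊃ ⋯ ⊃ S_m ⊃ S_{m+1} = ∅` of a semigroup:
a strictly decreasing chain of ideals with no ideal strictly between consecutive
terms (the empty set counts as an ideal). -/
structure PrincipalSeries (S : Type*) [Semigroup S] where
  m : ℕ
  C : ℕ → Set S
  first : C 1 = Set.univ
  last : C (m + 1) = ∅
  ideal : ∀ i, 1 ≤ i → i ≤ m → IsIdealIn Set.univ (C i)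
  ssub : ∀ i, 1 ≤ i → i ≤ m → C (i + 1) ⊂ C i
  maximal : ∀ i, 1 ≤ i → i ≤ m → ∀ I : Set S, IsIdealIn Set.univ I →
    C (i + 1) ⊆ I → I ⊆ C i → I = C (i + 1) ∨ I = C i

variable {S : Type*} [Semigroup S]

/-- `F_{S_j/S_{j+1}}(S/S_{j+1})`, computed in `S`:  the elements `s ∉ S_j` with
`s·a ≠ θ` or `a·s ≠ θ` in `S/S_{j+1}` for some `a` in the ideal `S_j/S_{j+1}`. -/
def FsetQ (ps : PrincipalSeries S) (j : ℕ) : Set S :=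
  {s | s ∉ ps.C j ∧ ∃ a ∈ ps.C j, s * a ∉ ps.C (j + 1) ∨ a * s ∉ ps.C (j + 1)}

/-- `S_i \ S_{i+1}` is a root: the principal factor `S_i/S_{i+1}` is not Mal'cev
nilpotent and there is no `N_S`-edge between `S_i \ S_{i+1}` and `S_{i+1}`. -/
def Root (ps : PrincipalSeries S) (i : ℕ) : Prop :=
  ¬ SetMNMod (ps.C (i + 1)) (ps.C i) ∧
  ∀ a ∈ ps.C i \ ps.C (i + 1), ∀ b ∈ ps.C (i + 1), ¬ NEdge a b

/-- `S_i \ S_{i+1}` is an isolated subset: it is not a root, and whenever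
`S_i \ S_{i+1} ⊆ F_{S_j/S_{j+1}}(S/S_{j+1})` the factor `S_j/S_{j+1}` is nilpotent. -/
def Isolated (ps : PrincipalSeries S) (i : ℕ) : Prop :=
  ¬ Root ps i ∧
  ∀ j, 1 ≤ j → j ≤ ps.m → ps.C i \ ps.C (i + 1) ⊆ FsetQ ps j →
    SetMNMod (ps.C (j + 1)) (ps.C j)

/-- `K`, the union of all isolated subsets `S_i \ S_{i+1}`. -/
def Kset (ps : PrincipalSeries S) : Set S :=
  {a | ∃ i, 1 ≤ i ∧ i ≤ ps.m ∧ Isolated ps i ∧ a ∈ ps.C i \ ps.C (i + 1)}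

/-- The stem `S^{(i)} = F_{S_i/S_{i+1}}(S/S_{i+1}) ∪ (S_i \ S_{i+1})` of a root. -/
def Stem (ps : PrincipalSeries S) (i : ℕ) : Set S :=
  FsetQ ps i ∪ (ps.C i \ ps.C (i + 1))

/-! ### Mal'cev sequences -/

lemma malcev_succ (x y : S) (w : ℕ → Option S) (n : ℕ) :
    malcev x y w (n + 1) =
      (mulW (malcev x y w n).1 (w n) (malcev x y w n).2,
        mulW (malcev x y w n).2 (w n) (malcev x y w n).1) := rfl

lemma malcev_const_succ (x y c : S) (n : ℕ) :
    malcev x y (fun _ => some c) (n + 1) =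
      malcev (x * c * y) (y * c * x) (fun _ => some c) n := by
  induction n with
  | zero => rfl
  | succ n ih => rw [malcev_succ, ih, malcev_succ]

lemma mulW_mem (A : Subsemigroup S) {a b : S} {w : Option S} (ha : a ∈ A) (hb : b ∈ A)
    (hw : ∀ c, w = some c → c ∈ A) : mulW a w b ∈ A := by
  cases w with
  | none => exact A.mul_mem ha hb
  | some c => exact A.mul_mem (A.mul_mem ha (hw c rfl)) hb

lemma malcev_mem (A : Subsemigroup S) {x y : S} {w : ℕ → Option S} (hx : x ∈ A) (hy : y ∈ A)
    (hw : ∀ k c, w k = some c → c ∈ A) (n : ℕ) :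
    (malcev x y w n).1 ∈ A ∧ (malcev x y w n).2 ∈ A := by
  induction n with
  | zero => exact ⟨hx, hy⟩
  | succ n ih => exact ⟨mulW_mem A ih.1 ih.2 (hw n), mulW_mem A ih.2 ih.1 (hw n)⟩

lemma mulW_mem_of_left {Z : Set S} (hZ : IsIdealIn Set.univ Z) {a : S} (ha : a ∈ Z)
    (w : Option S) (b : S) : mulW a w b ∈ Z := by
  cases w with
  | none => exact (hZ.2 a ha b trivial).2
  | some c => exact (hZ.2 _ (hZ.2 a ha c trivial).2 b trivial).2

lemma mulW_mem_of_right {Z : Set S} (hZ : IsIdealIn Set.univ Z) {b : S} (hb : b ∈ Z)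
    (w : Option S) (a : S) : mulW a w b ∈ Z := by
  cases w with
  | none => exact (hZ.2 b hb a trivial).1
  | some c => exact (hZ.2 b hb _ trivial).1

/-- Once one of the two Mal'cev terms lies in `Z`, or they coincide, the terms agree modulo `Z`
from the next step on. -/
def MalcevCollapsed (Z : Set S) (p : S × S) : Prop :=
  p.1 ∈ Z ∨ p.2 ∈ Z ∨ p.1 = p.2

lemma MalcevCollapsed.reesEq_succ {Z : Set S} (hZ : IsIdealIn Set.univ Z) {x y : S}
    {w : ℕ → Option S} {n : ℕ} (h : MalcevCollapsed Z (malcev x y w n)) :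
    ReesEq Z (malcev x y w (n + 1)).1 (malcev x y w (n + 1)).2 := by
  rw [malcev_succ]
  rcases h with h | h | h
  · exact Or.inr ⟨mulW_mem_of_left hZ h _ _, mulW_mem_of_right hZ h _ _⟩
  · exact Or.inr ⟨mulW_mem_of_right hZ h _ _, mulW_mem_of_left hZ h _ _⟩
  · exact Or.inl (by simp only [h])

lemma ReesEq.malcevCollapsed {Z : Set S} {p : S × S} (h : ReesEq Z p.1 p.2) :
    MalcevCollapsed Z p := by
  rcases h with h | h
  · exact Or.inr (Or.inr h)
  · exact Or.inl h.1

lemma MalcevCollapsed.reesEq_of_lt {Z : Set S} (hZ : IsIdealIn Set.univ Z) {x y : S}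
    {w : ℕ → Option S} {n m : ℕ} (h : MalcevCollapsed Z (malcev x y w n)) (hnm : n < m) :
    ReesEq Z (malcev x y w m).1 (malcev x y w m).2 := by
  induction m, hnm using Nat.le_induction with
  | base => exact h.reesEq_succ hZ
  | succ m _ ih => exact ih.malcevCollapsed.reesEq_succ hZ

lemma SetMN.setMNMod {A : Set S} (h : SetMN A) (Z : Set S) : SetMNMod Z A := by
  obtain ⟨n, hn, h⟩ := h
  exact ⟨n, hn, fun x hx y hy w hw => Or.inl (h x hx y hy w hw)⟩

/-- In a pseudo-nilpotent finite semigroup, a long Mal'cev sequence which never collapses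
modulo an ideal starts with two elements generating a non-nilpotent semigroup modulo it. -/
lemma IsPN.not_setMNMod [Finite S] (hPN : IsPN S) {Z : Set S} (hZ : IsIdealIn Set.univ Z)
    {x y : S} {w : ℕ → Option S}
    (h : ∀ n ≤ Nat.card (S × S), ¬ MalcevCollapsed Z (malcev x y w n)) :
    ¬ SetMNMod Z (Subsemigroup.closure ({x, y} : Set S) : Set S) := by
  rintro ⟨n, hn, hnil⟩
  have : ∃ t m, t < m ∧ m ≤ Nat.card (S × S) ∧ malcev x y w t = malcev x y w m := by
    have hni : ¬ Function.Injective
        (fun k : Fin (Nat.card (S × S) + 1) => malcev x y w k) := fun hi => by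
      have := Nat.card_le_card_of_injective _ hi
      simp at this
    simp only [Function.Injective, not_forall] at hni
    obtain ⟨a, b, hab, hne⟩ := hni
    rcases lt_or_gt_of_ne hne with hlt | hlt
    · exact ⟨a, b, hlt, Nat.lt_succ_iff.1 b.2, hab⟩
    · exact ⟨b, a, hlt, Nat.lt_succ_iff.1 a.2, hab.symm⟩
  obtain ⟨t, m, htm, hm, heq⟩ := this
  have hcm := h m hm
  have hct := h t (htm.le.trans hm)
  simp only [MalcevCollapsed, not_or] at hcm hct
  have hle : Subsemigroup.closure ({x, y} : Set S) ≤ Subsemigroup.closure (genSet x y w m) :=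
    Subsemigroup.closure_mono Set.subset_union_left
  refine hPN x y w m (Z ∩ Subsemigroup.closure (genSet x y w m)) ⟨Set.inter_subset_right, ?_⟩
    (fun hmem => hcm.1 hmem.1) (fun hmem => hcm.2.1 hmem.1) ⟨t, htm, hct.2.2, heq⟩
    0 (Nat.zero_le _) ⟨n, hn, ?_⟩
  · exact fun a ha s hs => ⟨⟨(hZ.2 a ha.1 s trivial).1, mul_mem hs ha.2⟩,
      ⟨(hZ.2 a ha.1 s trivial).2, mul_mem ha.2 hs⟩⟩
  · intro a ha b hb v hv
    have hmem := malcev_mem (Subsemigroup.closure ({x, y} : Set S)) ha hb hv n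
    rcases hnil a ha b hb v hv with h | h
    · exact Or.inl h
    · exact Or.inr ⟨⟨h.1, hle hmem.1⟩, ⟨h.2, hle hmem.2⟩⟩

lemma mul_comm_of_mem_closure {s : Set S} (hs : ∀ a ∈ s, ∀ b ∈ s, a * b = b * a) {a b : S}
    (ha : a ∈ Subsemigroup.closure s) (hb : b ∈ Subsemigroup.closure s) : a * b = b * a :=
  Set.centralizer_centralizer_comm_of_comm hs _
    (Subsemigroup.closure_le_centralizer_centralizer s ha) _
    (Subsemigroup.closure_le_centralizer_centralizer s hb)

lemma setMN_of_comm {A : Subsemigroup S} (h : ∀ a ∈ A, ∀ b ∈ A, a * b = b * a) :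
    SetMN (A : Set S) := by
  refine ⟨1, one_pos, fun a ha b hb w hw => ?_⟩
  rw [malcev_succ]
  change mulW a (w 0) b = mulW b (w 0) a
  cases hc : w 0 with
  | none => exact h a ha b hb
  | some c =>
    have hcA := hw 0 c hc
    change a * c * b = b * c * a
    rw [h _ (A.mul_mem ha hcA) b hb, h a ha c hcA, mul_assoc]

lemma setMNMod_of_absorbing {Z : Set S} (hZ : IsIdealIn Set.univ Z) {A C : Subsemigroup S}
    (hC : ∀ a ∈ C, ∀ b ∈ C, a * b = b * a)
    (h : ∀ z ∈ A, (∀ a ∈ A, a * z ∈ Z) ∨ (∀ a ∈ A, z * a ∈ Z) ∨ z ∈ C) :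
    SetMNMod Z (A : Set S) := by
  refine ⟨2, two_pos, fun a ha b hb w hw => ?_⟩
  refine MalcevCollapsed.reesEq_succ hZ (n := 1) ?_
  rw [malcev_succ]
  change mulW a (w 0) b ∈ Z ∨ mulW b (w 0) a ∈ Z ∨ mulW a (w 0) b = mulW b (w 0) a
  cases hc : w 0 with
  | none =>
    change a * b ∈ Z ∨ b * a ∈ Z ∨ a * b = b * a
    rcases h a ha with h1 | h1 | h1
    · exact Or.inr (Or.inl (h1 b hb))
    · exact Or.inl (h1 b hb)
    rcases h b hb with h2 | h2 | h2
    · exact Or.inl (h2 a ha)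
    · exact Or.inr (Or.inl (h2 a ha))
    exact Or.inr (Or.inr (hC a h1 b h2))
  | some c =>
    have hcA := hw 0 c hc
    change a * c * b ∈ Z ∨ b * c * a ∈ Z ∨ a * c * b = b * c * a
    rcases h a ha with h1 | h1 | h1
    · exact Or.inr (Or.inl (h1 _ (A.mul_mem hb hcA)))
    · exact Or.inl (mul_assoc a c b ▸ h1 _ (A.mul_mem hcA hb))
    rcases h b hb with h2 | h2 | h2
    · exact Or.inl (h2 _ (A.mul_mem ha hcA))
    · exact Or.inr (Or.inl (mul_assoc b c a ▸ h2 _ (A.mul_mem hcA ha)))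
    rcases h c hcA with h3 | h3 | h3
    · exact Or.inl (hZ.2 _ (h3 a ha) b trivial).2
    · exact Or.inl (mul_assoc a c b ▸ (hZ.2 _ (h3 b hb) a trivial).1)
    exact Or.inr (Or.inr
      (by rw [hC _ (C.mul_mem h1 h3) b h2, hC a h1 c h3, mul_assoc]))

lemma setMNMod_closure_pair_of_left {Z : Set S} (hZ : IsIdealIn Set.univ Z) {x y : S}
    (hxx : x * x ∈ Z) (hyx : y * x ∈ Z) :
    SetMNMod Z (Subsemigroup.closure ({x, y} : Set S) : Set S) := by
  have hx : ∀ a ∈ Subsemigroup.closure ({x, y} : Set S), a * x ∈ Z := by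
    intro a ha
    induction ha using Subsemigroup.closure_induction with
    | mem a ha => rcases ha with rfl | rfl <;> assumption
    | mul a b _ _ _ hb => exact mul_assoc a b x ▸ (hZ.2 _ hb a trivial).1
  refine setMNMod_of_absorbing hZ (C := Subsemigroup.closure {y})
    (fun a ha b hb => mul_comm_of_mem_closure (by simp) ha hb) fun z hz => ?_
  induction hz using Subsemigroup.closure_induction with
  | mem z hz =>
    rcases hz with rfl | rfl
    · exact Or.inl hx
    · exact Or.inr (Or.inr (Subsemigroup.subset_closure rfl))
  | mul u v hu hv hu' hv' =>
    rcases hu' with h1 | h1 | h1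
    · exact Or.inl fun a ha => mul_assoc a u v ▸ (hZ.2 _ (h1 a ha) v trivial).2
    · exact Or.inr (Or.inl fun a ha => mul_assoc u v a ▸ h1 _ (mul_mem hv ha))
    rcases hv' with h2 | h2 | h2
    · exact Or.inl fun a ha => mul_assoc a u v ▸ h2 _ (mul_mem ha hu)
    · exact Or.inr (Or.inl fun a ha => mul_assoc u v a ▸ (hZ.2 _ (h2 a ha) u trivial).1)
    exact Or.inr (Or.inr (mul_mem h1 h2))

lemma setMNMod_closure_pair_of_right {Z : Set S} (hZ : IsIdealIn Set.univ Z) {x y : S}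
    (hxx : x * x ∈ Z) (hxy : x * y ∈ Z) :
    SetMNMod Z (Subsemigroup.closure ({x, y} : Set S) : Set S) := by
  have hx : ∀ a ∈ Subsemigroup.closure ({x, y} : Set S), x * a ∈ Z := by
    intro a ha
    induction ha using Subsemigroup.closure_induction with
    | mem a ha => rcases ha with rfl | rfl <;> assumption
    | mul a b _ _ ha _ => exact mul_assoc x a b ▸ (hZ.2 _ ha b trivial).2
  refine setMNMod_of_absorbing hZ (C := Subsemigroup.closure {y})
    (fun a ha b hb => mul_comm_of_mem_closure (by simp) ha hb) fun z hz => ?_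
  induction hz using Subsemigroup.closure_induction with
  | mem z hz =>
    rcases hz with rfl | rfl
    · exact Or.inr (Or.inl hx)
    · exact Or.inr (Or.inr (Subsemigroup.subset_closure rfl))
  | mul u v hu hv hu' hv' =>
    rcases hu' with h1 | h1 | h1
    · exact Or.inl fun a ha => mul_assoc a u v ▸ (hZ.2 _ (h1 a ha) v trivial).2
    · exact Or.inr (Or.inl fun a ha => mul_assoc u v a ▸ h1 _ (mul_mem hv ha))
    rcases hv' with h2 | h2 | h2
    · exact Or.inl fun a ha => mul_assoc a u v ▸ h2 _ (mul_mem ha hu)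
    · exact Or.inr (Or.inl fun a ha => mul_assoc u v a ▸ (hZ.2 _ (h2 a ha) u trivial).1)
    exact Or.inr (Or.inr (mul_mem h1 h2))

/-! ### Green's relations inside a non-null principal factor -/

/-- A form of Green's relation `R`: each element is a right multiple of the other. -/
def GreenR (a b : S) : Prop := (∃ u, b * u = a) ∧ ∃ v, a * v = b

/-- A form of Green's relation `L`: each element is a left multiple of the other. -/
def GreenL (a b : S) : Prop := (∃ u, u * b = a) ∧ ∃ v, v * a = b

lemma GreenR.symm {a b : S} (h : GreenR a b) : GreenR b a := ⟨h.2, h.1⟩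

lemma GreenL.symm {a b : S} (h : GreenL a b) : GreenL b a := ⟨h.2, h.1⟩

lemma GreenR.trans {a b c : S} (h : GreenR a b) (h' : GreenR b c) : GreenR a c := by
  obtain ⟨⟨u, rfl⟩, v, hv⟩ := h
  obtain ⟨⟨u', rfl⟩, v', hv'⟩ := h'
  exact ⟨⟨u' * u, (mul_assoc _ _ _).symm⟩, v * v', by rw [← mul_assoc, hv, hv']⟩

lemma GreenL.trans {a b c : S} (h : GreenL a b) (h' : GreenL b c) : GreenL a c := by
  obtain ⟨⟨u, rfl⟩, v, hv⟩ := h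
  obtain ⟨⟨u', rfl⟩, v', hv'⟩ := h'
  exact ⟨⟨u * u', mul_assoc _ _ _⟩, v' * v, by rw [mul_assoc, hv, hv']⟩

/-- The properties used of a non-null principal factor `T / Z` of a finite semigroup. -/
structure IsRegularFactor (Z T : Set S) : Prop where
  idealZ : IsIdealIn Set.univ Z
  idealT : IsIdealIn Set.univ T
  stabR : ∀ a ∈ T, ∀ s, a * s ∉ Z → ∃ v, a * s * v = a
  stabL : ∀ a ∈ T, ∀ s, s * a ∉ Z → ∃ v, v * (s * a) = a
  link : ∀ a ∈ T, a ∉ Z → ∀ b ∈ T, b ∉ Z → ∃ u, a * u * b ∉ Z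

namespace IsRegularFactor

variable {Z T : Set S} (F : IsRegularFactor Z T)
include F

lemma left_notMem {a b : S} (h : a * b ∉ Z) : a ∉ Z := fun ha => h (F.idealZ.2 a ha b trivial).2

lemma right_notMem {a b : S} (h : a * b ∉ Z) : b ∉ Z := fun hb => h (F.idealZ.2 b hb a trivial).1

lemma mul_left_mem {a : S} (ha : a ∈ T) (s : S) : s * a ∈ T := (F.idealT.2 a ha s trivial).1

lemma mul_right_mem {a : S} (ha : a ∈ T) (s : S) : a * s ∈ T := (F.idealT.2 a ha s trivial).2

lemma chain {a b c : S} (hb : b ∈ T) (hab : a * b ∉ Z) (hbc : b * c ∉ Z) : a * b * c ∉ Z := by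
  obtain ⟨v, hv⟩ := F.stabR b hb c hbc
  intro h
  apply hab
  have := (F.idealZ.2 _ h v trivial).2
  rwa [mul_assoc a b c, mul_assoc, hv] at this

lemma greenR_mul {a s : S} (ha : a ∈ T) (h : a * s ∉ Z) : GreenR (a * s) a :=
  ⟨⟨s, rfl⟩, F.stabR a ha s h⟩

lemma greenL_mul {a s : S} (ha : a ∈ T) (h : s * a ∉ Z) : GreenL (s * a) a :=
  ⟨⟨s, rfl⟩, F.stabL a ha s h⟩

lemma greenR_refl {a : S} (ha : a ∈ T) (ha' : a ∉ Z) : GreenR a a := by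
  obtain ⟨u, hu⟩ := F.link a ha ha' a ha ha'
  have := F.greenR_mul ha (F.left_notMem hu)
  exact this.symm.trans this

lemma greenL_refl {a : S} (ha : a ∈ T) (ha' : a ∉ Z) : GreenL a a := by
  obtain ⟨u, hu⟩ := F.link a ha ha' a ha ha'
  rw [mul_assoc] at hu
  have := F.greenL_mul ha (F.right_notMem hu)
  exact this.symm.trans this

lemma exists_regular {a : S} (ha : a ∈ T) (ha' : a ∉ Z) : ∃ r, a * r * a = a := by
  obtain ⟨u, hu⟩ := F.link a ha ha' a ha ha'
  obtain ⟨v, hv⟩ := F.stabL a ha (a * u) hu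
  obtain ⟨r, hr⟩ := F.stabR (a * u) (F.mul_right_mem ha u) a hu
  refine ⟨r, ?_⟩
  calc a * r * a = v * (a * u * a) * r * a := by rw [hv]
    _ = v * (a * u * a * r * a) := by simp only [mul_assoc]
    _ = a := by rw [hr, hv]

/-- The data guaranteeing that iterating `(x, y) ↦ (x c y, y c x)` never collapses. -/
def Persistent (Z T : Set S) (c x y : S) : Prop :=
  x ∈ T ∧ y ∈ T ∧ x * c ∉ Z ∧ c * x ∉ Z ∧ y * c ∉ Z ∧ c * y ∉ Z ∧ ¬ (GreenR x y ∧ GreenL x y)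

lemma persistent_step {c x y : S} (hc : c ∈ T) (h : Persistent Z T c x y) :
    Persistent Z T c (x * c * y) (y * c * x) := by
  obtain ⟨hx, hy, hxc, hcx, hyc, hcy, hH⟩ := h
  have h1 : x * c * y ∉ Z := F.chain hc hxc hcy
  have h2 : y * c * x ∉ Z := F.chain hc hyc hcx
  refine ⟨F.mul_left_mem hy _, F.mul_left_mem hx _, ?_, ?_, ?_, ?_, fun h => hH ⟨?_, ?_⟩⟩
  · exact F.chain hy h1 hyc
  · have := F.chain hx hcx (mul_assoc x c y ▸ h1)
    simpa only [mul_assoc] using this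
  · exact F.chain hx h2 hxc
  · have := F.chain hy hcy (mul_assoc y c x ▸ h2)
    simpa only [mul_assoc] using this
  · rw [mul_assoc] at h1 h2
    rw [mul_assoc x, mul_assoc y] at h
    exact (F.greenR_mul hx h1).symm.trans (h.1.trans (F.greenR_mul hy h2))
  · exact (F.greenL_mul hx h2).symm.trans (h.2.symm.trans (F.greenL_mul hy h1))

lemma Persistent.not_collapsed {c x y : S} (h : Persistent Z T c x y) :
    ¬ MalcevCollapsed Z (x, y) := by
  obtain ⟨hx, hy, hxc, hcx, hyc, hcy, hH⟩ := h
  rintro (h | h | h)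
  · exact F.left_notMem hxc h
  · exact F.left_notMem hyc h
  · have h : x = y := h
    subst h
    exact hH ⟨F.greenR_refl hx (F.left_notMem hxc), F.greenL_refl hx (F.left_notMem hxc)⟩

lemma Persistent.malcev_not_collapsed {c x y : S} (hc : c ∈ T) (h : Persistent Z T c x y)
    (n : ℕ) : ¬ MalcevCollapsed Z (malcev x y (fun _ => some c) n) := by
  induction n generalizing x y with
  | zero => exact Persistent.not_collapsed F h
  | succ n ih =>
    rw [malcev_const_succ]
    exact ih (F.persistent_step hc h)

lemma mul_self_or [Finite S] (hPN : IsPN S) {c x y : S} (hc : c ∈ T)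
    (h : Persistent Z T c x y) : x * x ∉ Z ∨ (y * x ∉ Z ∧ x * y ∉ Z) := by
  have hn := hPN.not_setMNMod F.idealZ
    (fun n _ => Persistent.malcev_not_collapsed F hc h n)
  by_contra! hcon
  obtain ⟨hxx, hcon⟩ := hcon
  by_cases hyx : y * x ∈ Z
  · exact hn (setMNMod_closure_pair_of_left F.idealZ hxx hyx)
  · exact hn (setMNMod_closure_pair_of_right F.idealZ hxx (hcon hyx))

lemma row_notMem [Finite S] (hPN : IsPN S) {x y c d : S} (hx : x ∈ T) (hy : y ∈ T)
    (hc : c ∈ T) (hd : d ∈ T) (hd' : d ∉ Z) (hR : ¬ GreenR x y) (hcx : c * x ∉ Z)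
    (hcy : c * y ∉ Z) : d * x ∉ Z := by
  obtain ⟨u, hu⟩ := F.link x hx (F.right_notMem hcx) d hd hd'
  obtain ⟨v, hv⟩ := F.link y hy (F.right_notMem hcy) d hd hd'
  obtain ⟨p, hp⟩ := F.link d hd hd' c hc (F.left_notMem hcx)
  have hp' : d * (p * c) ∉ Z := mul_assoc d p c ▸ hp
  have key : ∀ {z t : S}, z ∈ T → c * z ∉ Z → z * t * d ∉ Z → p * c * (z * t * d) ∉ Z := by
    intro z t hz hcz hzt
    have h1 : p * c * z ∉ Z := by
      have := F.chain hc hp hcz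
      rw [mul_assoc d, mul_assoc d] at this
      exact F.right_notMem this
    rw [mul_assoc z] at hzt ⊢
    have := F.chain hz h1 hzt
    rwa [mul_assoc] at this
  have hpers : Persistent Z T (p * c) (x * u * d) (y * v * d) := by
    refine ⟨F.mul_left_mem hd _, F.mul_left_mem hd _, F.chain hd hu hp', key hx hcx hu,
      F.chain hd hv hp', key hy hcy hv, fun h => hR ?_⟩
    rw [mul_assoc] at hu hv
    rw [mul_assoc x, mul_assoc y] at h
    exact (F.greenR_mul hx hu).symm.trans (h.1.trans (F.greenR_mul hy hv))
  have hsub : ∀ z, z * d * (x * u * d) ∉ Z → d * x ∉ Z := by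
    intro z hz
    have : z * (d * x) * (u * d) ∉ Z := by simpa only [mul_assoc] using hz
    exact F.right_notMem (F.left_notMem this)
  rcases F.mul_self_or hPN (F.mul_left_mem hc p) hpers with h | h
  · exact hsub _ h
  · exact hsub _ h.1

lemma column_notMem [Finite S] (hPN : IsPN S) {x y c d : S} (hx : x ∈ T) (hy : y ∈ T)
    (hc : c ∈ T) (hd : d ∈ T) (hd' : d ∉ Z) (hL : ¬ GreenL x y) (hxc : x * c ∉ Z)
    (hyc : y * c ∉ Z) : x * d ∉ Z := by
  obtain ⟨u, hu⟩ := F.link d hd hd' x hx (F.left_notMem hxc)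
  obtain ⟨v, hv⟩ := F.link d hd hd' y hy (F.left_notMem hyc)
  obtain ⟨p, hp⟩ := F.link c hc (F.right_notMem hxc) d hd hd'
  have key : ∀ {z t : S}, z ∈ T → z * c ∉ Z → d * t * z ∉ Z → d * t * z * (c * p) ∉ Z := by
    intro z t hz hzc hzt
    have h1 : z * (c * p) ∉ Z := by
      have := F.chain hc hzc (mul_assoc c p d ▸ hp)
      have : z * (c * p) * d ∉ Z := by simpa only [mul_assoc] using this
      exact F.left_notMem this
    exact F.chain hz hzt h1
  have key' : ∀ {z t : S}, d * t * z ∉ Z → c * p * (d * t * z) ∉ Z := by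
    intro z t hzt
    have := F.chain hd hp (mul_assoc d t z ▸ hzt)
    simpa only [mul_assoc] using this
  have hpers : Persistent Z T (c * p) (d * u * x) (d * v * y) :=
    ⟨F.mul_left_mem hx _, F.mul_left_mem hy _, key hx hxc hu, key' hu, key hy hyc hv, key' hv,
      fun h => hL ((F.greenL_mul hx hu).symm.trans (h.2.trans (F.greenL_mul hy hv)))⟩
  have hsub : ∀ z, d * u * x * (d * z) ∉ Z → x * d ∉ Z := by
    intro z hz
    have : d * u * (x * d) * z ∉ Z := by simpa only [mul_assoc] using hz
    exact F.right_notMem (F.left_notMem this)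
  rcases F.mul_self_or hPN (F.mul_right_mem hc p) hpers with h | h
  · exact hsub (u * x) (by simpa only [mul_assoc] using h)
  · exact hsub (v * y) (by simpa only [mul_assoc] using h.2)

lemma mul_notMem_of_row [Finite S] (hPN : IsPN S) {x y c : S} (hx : x ∈ T) (hy : y ∈ T)
    (hc : c ∈ T) (hR : ¬ GreenR x y) (hcx : c * x ∉ Z) (hcy : c * y ∉ Z) {a b : S}
    (ha : a ∈ T) (ha' : a ∉ Z) (hb : b ∈ T) (hb' : b ∉ Z) : a * b ∉ Z := by
  obtain ⟨u, hu⟩ := F.link b hb hb' b hb hb'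
  rw [mul_assoc] at hu
  have hub := F.right_notMem hu
  by_cases hL : GreenL a (b * u)
  · obtain ⟨-, v, hv⟩ := hL
    rw [← mul_assoc, ← hv, mul_assoc] at hu
    exact F.right_notMem hu
  · have hbu : b * u ∉ Z := fun h => hu (mul_assoc b u b ▸ (F.idealZ.2 _ h b trivial).2)
    have hbuT := F.mul_right_mem hb u
    exact F.column_notMem hPN ha hbuT hx hb hb' hL
      (F.row_notMem hPN hx hy hc ha ha' hR hcx hcy)
      (F.row_notMem hPN hx hy hc hbuT hbu hR hcx hcy)

lemma mul_notMem_of_column [Finite S] (hPN : IsPN S) {x y c : S} (hx : x ∈ T) (hy : y ∈ T)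
    (hc : c ∈ T) (hL : ¬ GreenL x y) (hxc : x * c ∉ Z) (hyc : y * c ∉ Z) {a b : S}
    (ha : a ∈ T) (ha' : a ∉ Z) (hb : b ∈ T) (hb' : b ∉ Z) : a * b ∉ Z := by
  obtain ⟨u, hu⟩ := F.link a ha ha' a ha ha'
  by_cases hR : GreenR b (u * a)
  · obtain ⟨-, v, hv⟩ := hR
    rw [mul_assoc, ← hv, ← mul_assoc] at hu
    exact F.left_notMem hu
  · rw [mul_assoc] at hu
    have hua := F.right_notMem hu
    have huaT := F.mul_left_mem ha u
    exact F.row_notMem hPN hb huaT hx ha ha' hR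
      (F.column_notMem hPN hx hy hc hb hb' hL hxc hyc)
      (F.column_notMem hPN hx hy hc huaT hua hL hxc hyc)

/-- A long non-collapsing Mal'cev sequence cannot start inside one `H`-class. -/
lemma not_green_of_malcev [Finite S] (hPN : IsPN S) {x y : S} {w : ℕ → Option S} (hy : y ∈ T)
    (h : ∀ n ≤ Nat.card (S × S), ¬ MalcevCollapsed Z (malcev x y w n)) :
    ¬ (GreenR x y ∧ GreenL x y) := by
  rintro ⟨⟨⟨s, hs⟩, -⟩, ⟨t, ht⟩, -⟩
  have hy' : y ∉ Z := fun hyZ => h 0 (Nat.zero_le _) (Or.inr (Or.inl hyZ))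
  obtain ⟨r, hr⟩ := F.exists_regular hy hy'
  have hxr : x * r * y = x := by
    rw [← ht, mul_assoc, mul_assoc, ← mul_assoc y, hr]
  have hrx : y * r * x = x := by
    rw [← hs, ← mul_assoc, hr]
  let w' : ℕ → Option S := fun n => some (match w n with
    | none => y
    | some c => y * c)
  have hmul : ∀ a b n, mulW a (w' n) b * y = mulW (a * y) (w n) (b * y) := by
    intro a b n
    simp only [w', mulW]
    cases w n <;> simp only [mul_assoc]
  have hmal : ∀ n, ((malcev (x * r) (y * r) w' n).1 * y, (malcev (x * r) (y * r) w' n).2 * y) =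
      malcev x y w n := by
    intro n
    induction n with
    | zero => exact Prod.ext hxr hr
    | succ n ih => simp only [malcev_succ, hmul, ← ih]
  refine hPN.not_setMNMod F.idealZ (x := x * r) (y := y * r) (w := w') (fun n hn hcol => ?_)
    (SetMN.setMNMod (setMN_of_comm fun a ha b hb => mul_comm_of_mem_closure ?_ ha hb) Z)
  · apply h n hn
    rw [← hmal]
    rcases hcol with hcol | hcol | hcol
    · exact Or.inl (F.idealZ.2 _ hcol y trivial).2
    · exact Or.inr (Or.inl (F.idealZ.2 _ hcol y trivial).2)
    · exact Or.inr (Or.inr (congrArg (· * y) hcol))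
  · have hcomm : x * r * (y * r) = y * r * (x * r) := by
      rw [← mul_assoc, hxr, ← mul_assoc (y * r), hrx]
    rintro a (rfl | rfl) b (rfl | rfl)
    exacts [rfl, hcomm, hcomm.symm, rfl]

/-- In a pseudo-nilpotent finite semigroup, a principal factor with a long non-collapsing Mal'cev
sequence has no zero divisors and more than one `H`-class. -/
lemma mul_notMem_of_malcev [Finite S] (hPN : IsPN S) {x y : S} {w : ℕ → Option S}
    (hx : x ∈ T) (hy : y ∈ T) (hw : ∀ k c, w k = some c → c ∈ T)
    (h : ∀ n ≤ Nat.card (S × S) + 1, ¬ MalcevCollapsed Z (malcev x y w n)) {a b : S}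
    (ha : a ∈ T) (ha' : a ∉ Z) (hb : b ∈ T) (hb' : b ∉ Z) : a * b ∉ Z := by
  have hH := F.not_green_of_malcev hPN hy (fun n hn => h n (by omega))
  have hcross : ∀ c ∈ T, c * x ∉ Z → c * y ∉ Z → x * c ∉ Z → y * c ∉ Z → a * b ∉ Z := by
    intro c hc hcx hcy hxc hyc
    by_cases hR : GreenR x y
    · exact F.mul_notMem_of_column hPN hx hy hc (fun hL => hH ⟨hR, hL⟩) hxc hyc ha ha' hb hb'
    · exact F.mul_notMem_of_row hPN hx hy hc hR hcx hcy ha ha' hb hb'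
  have : Nonempty S := ⟨x⟩
  have hpos : 0 < Nat.card (S × S) := Nat.card_pos
  have h1 := h 1 (by omega)
  have h2 := h 2 (by omega)
  simp only [malcev_succ, MalcevCollapsed, not_or] at h1 h2
  simp only [malcev] at h1 h2
  cases hw0 : w 0 with
  | some c =>
    simp only [hw0, mulW] at h1
    obtain ⟨h11, h12, -⟩ := h1
    exact hcross c (hw 0 c hw0) (F.right_notMem (mul_assoc y c x ▸ h12))
      (F.right_notMem (mul_assoc x c y ▸ h11)) (F.left_notMem h11) (F.left_notMem h12)
  | none =>
    simp only [hw0, mulW] at h1 h2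
    obtain ⟨hxy, hyx, -⟩ := h1
    cases hw1 : w 1 with
    | some c =>
      simp only [hw1] at h2
      obtain ⟨h21, h22, -⟩ := h2
      have hyc : y * c ∉ Z := by
        have : x * (y * c) * (y * x) ∉ Z := by simpa only [mul_assoc] using h21
        exact F.right_notMem (F.left_notMem this)
      have hcy : c * y ∉ Z := by
        have : x * y * (c * y) * x ∉ Z := by simpa only [mul_assoc] using h21
        exact F.right_notMem (F.left_notMem this)
      have hxc : x * c ∉ Z := by
        have : y * (x * c) * (x * y) ∉ Z := by simpa only [mul_assoc] using h22
        exact F.right_notMem (F.left_notMem this)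
      have hcx : c * x ∉ Z := by
        have : y * x * (c * x) * y ∉ Z := by simpa only [mul_assoc] using h22
        exact F.right_notMem (F.left_notMem this)
      exact hcross c (hw 1 c hw1) hcx hcy hxc hyc
    | none =>
      simp only [hw1] at h2
      have hxx : x * x ∉ Z := by
        have : y * (x * x) * y ∉ Z := by simpa only [mul_assoc] using h2.2.1
        exact F.right_notMem (F.left_notMem this)
      exact hcross x hx hxx hxy hxx hyx

/-- If a factor has no zero divisors, `c` belongs to it and `a c b`, `b c a` are not `H`-related,
then `a` and `b` are adjacent. -/
lemma nEdge [Finite S] (hPN : IsPN S) (hmul : ∀ a ∈ T, a ∉ Z → ∀ b ∈ T, b ∉ Z → a * b ∉ Z)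
    {a b c : S} (hc : c ∈ T) (hac : a * c ∉ Z) (hca : c * a ∉ Z) (hbc : b * c ∉ Z)
    (hcb : c * b ∉ Z) (hH : ¬ (GreenR (a * c * b) (b * c * a) ∧ GreenL (a * c * b) (b * c * a))) :
    NEdge a b := by
  have hcT : ∀ s, c * s ∈ T := F.mul_right_mem hc
  have hTc : ∀ s, s * c ∈ T := F.mul_left_mem hc
  have hc' := F.right_notMem hac
  have hacb : a * c * b ∉ Z := F.chain hc hac hcb
  have hbca : b * c * a ∉ Z := F.chain hc hbc hca
  have hacbT : a * c * b ∈ T := F.mul_right_mem (hTc a) b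
  have hbcaT : b * c * a ∈ T := F.mul_right_mem (hTc b) a
  have hpers : Persistent Z T c (a * c * b) (b * c * a) :=
    ⟨hacbT, hbcaT, hmul _ hacbT hacb _ hc hc', hmul _ hc hc' _ hacbT hacb,
      hmul _ hbcaT hbca _ hc hc', hmul _ hc hc' _ hbcaT hbca, hH⟩
  have hne : a ≠ b := by
    rintro rfl
    exact hH ⟨F.greenR_refl hacbT hacb, F.greenL_refl hacbT hacb⟩
  refine ⟨hne, fun hMN => hPN.not_setMNMod F.idealZ (w := fun _ => some c) (fun n _ => ?_)
    (hMN.setMNMod Z)⟩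
  cases n with
  | zero =>
    rintro (h | h | h)
    exacts [F.left_notMem hac h, F.left_notMem hbc h, hne h]
  | succ n =>
    rw [malcev_const_succ]
    exact Persistent.malcev_not_collapsed F hc hpers n

end IsRegularFactor

/-! ### Principal factors of a principal series -/

lemma exists_mul_eq_of_mul_eq [Finite S] {a r q : S} (h : r * a * q = a) : ∃ v, a * q * v = a := by
  let A : Set S := insert a (Set.range (a * ·))
  let B : Set S := insert (a * q) (Set.range (a * q * ·))
  have hBA : B ⊆ A := by
    rintro _ (rfl | ⟨s, rfl⟩)
    · exact Or.inr ⟨q, rfl⟩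
    · exact Or.inr ⟨q * s, (mul_assoc _ _ _).symm⟩
  have hAB : A ⊆ (r * ·) '' B := by
    rintro _ (rfl | ⟨s, rfl⟩)
    · exact ⟨_, Or.inl rfl, by simpa only [mul_assoc] using h⟩
    · exact ⟨_, Or.inr ⟨s, rfl⟩, by simp only [← mul_assoc, h]⟩
  have heq : B = A := Set.eq_of_subset_of_ncard_le hBA
    ((Set.ncard_le_ncard hAB (Set.toFinite _)).trans (Set.ncard_image_le (Set.toFinite _)))
  have ha : a ∈ B := heq ▸ Or.inl rfl
  rcases ha with ha | ⟨s, hs⟩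
  · exact ⟨q, by rw [← ha, ← ha]⟩
  · exact ⟨s, hs⟩

lemma exists_mul_eq_of_mul_eq' [Finite S] {a r q : S} (h : r * a * q = a) :
    ∃ v, v * (r * a) = a := by
  have : Finite Sᵐᵒᵖ := .of_equiv S MulOpposite.opEquiv
  obtain ⟨v, hv⟩ := exists_mul_eq_of_mul_eq (S := Sᵐᵒᵖ) (a := .op a) (r := .op q) (q := .op r)
    (by rw [← MulOpposite.op_mul, ← MulOpposite.op_mul, ← mul_assoc, h])
  exact ⟨v.unop, congrArg MulOpposite.unop hv⟩

/-- If no ideal lies strictly between the ideals `Z ⊆ T`, every element of `T` is obtained from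
any element of `T \ Z` by multiplications. -/
lemma mem_of_minimal {Z T : Set S} (hZ : IsIdealIn Set.univ Z) (hT : IsIdealIn Set.univ T)
    (hZT : Z ⊆ T) (hmin : ∀ I, IsIdealIn Set.univ I → Z ⊆ I → I ⊆ T → I = Z ∨ I = T)
    {a b : S} (ha : a ∈ T) (ha' : a ∉ Z) (hb : b ∈ T) (hb' : b ∉ Z) :
    b = a ∨ (∃ r, b = r * a) ∨ (∃ s, b = a * s) ∨ ∃ r s, b = r * a * s := by
  let I : Set S :=
    Z ∪ {b | b = a ∨ (∃ r, b = r * a) ∨ (∃ s, b = a * s) ∨ ∃ r s, b = r * a * s}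
  have hI : IsIdealIn Set.univ I := by
    refine ⟨Set.subset_univ _, ?_⟩
    rintro z (hz | rfl | ⟨r, rfl⟩ | ⟨s, rfl⟩ | ⟨r, s, rfl⟩) t -
    · exact ⟨Or.inl (hZ.2 z hz t trivial).1, Or.inl (hZ.2 z hz t trivial).2⟩
    · exact ⟨Or.inr (Or.inr (Or.inl ⟨t, rfl⟩)), Or.inr (Or.inr (Or.inr (Or.inl ⟨t, rfl⟩)))⟩
    · exact ⟨Or.inr (Or.inr (Or.inl ⟨t * r, by rw [mul_assoc]⟩)),
        Or.inr (Or.inr (Or.inr (Or.inr ⟨r, t, rfl⟩)))⟩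
    · exact ⟨Or.inr (Or.inr (Or.inr (Or.inr ⟨t, s, by rw [mul_assoc]⟩))),
        Or.inr (Or.inr (Or.inr (Or.inl ⟨s * t, by rw [mul_assoc]⟩)))⟩
    · exact ⟨Or.inr (Or.inr (Or.inr (Or.inr ⟨t * r, s, by simp only [mul_assoc]⟩))),
        Or.inr (Or.inr (Or.inr (Or.inr ⟨r, s * t, by simp only [mul_assoc]⟩)))⟩
  have hIT : I ⊆ T := by
    rintro z (hz | rfl | ⟨r, rfl⟩ | ⟨s, rfl⟩ | ⟨r, s, rfl⟩)
    · exact hZT hz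
    · exact ha
    · exact (hT.2 a ha r trivial).1
    · exact (hT.2 a ha s trivial).2
    · exact (hT.2 _ (hT.2 a ha r trivial).1 s trivial).2
  have haI : a ∈ I := Or.inr (Or.inl rfl)
  rcases hmin I hI Set.subset_union_left hIT with h | h
  · exact absurd (h ▸ haI) ha'
  · have hbI : b ∈ I := h ▸ hb
    exact hbI.resolve_left hb'

lemma isRegularFactor_of_minimal [Finite S] {Z T : Set S} (hZ : IsIdealIn Set.univ Z)
    (hT : IsIdealIn Set.univ T) (hZT : Z ⊆ T)
    (hmin : ∀ I, IsIdealIn Set.univ I → Z ⊆ I → I ⊆ T → I = Z ∨ I = T)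
    {b c : S} (hb : b ∈ T) (hc : c ∈ T) (hbc : b * c ∉ Z) : IsRegularFactor Z T := by
  have stabR : ∀ a ∈ T, ∀ s, a * s ∉ Z → ∃ v, a * s * v = a := by
    intro a ha s has
    have ha' : a ∉ Z := fun h => has (hZ.2 a h s trivial).2
    rcases mem_of_minimal hZ hT hZT hmin (hT.2 a ha s trivial).2 has ha ha' with
      h | ⟨r, h⟩ | ⟨t, h⟩ | ⟨r, t, h⟩
    · exact ⟨s, by rw [← h, ← h]⟩
    · exact exists_mul_eq_of_mul_eq (r := r) (by rw [mul_assoc, ← h])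
    · exact ⟨t, h.symm⟩
    · obtain ⟨v, hv⟩ := exists_mul_eq_of_mul_eq (a := a) (r := r) (q := s * t)
        (by simpa only [mul_assoc] using h.symm)
      exact ⟨t * v, by simpa only [mul_assoc] using hv⟩
  have stabL : ∀ a ∈ T, ∀ s, s * a ∉ Z → ∃ v, v * (s * a) = a := by
    intro a ha s has
    have ha' : a ∉ Z := fun h => has (hZ.2 a h s trivial).1
    rcases mem_of_minimal hZ hT hZT hmin (hT.2 a ha s trivial).1 has ha ha' with
      h | ⟨r, h⟩ | ⟨t, h⟩ | ⟨r, t, h⟩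
    · exact ⟨s, by rw [← h, ← h]⟩
    · exact ⟨r, h.symm⟩
    · exact exists_mul_eq_of_mul_eq' (q := t) h.symm
    · obtain ⟨v, hv⟩ := exists_mul_eq_of_mul_eq' (a := a) (r := r * s) (q := t)
        (by rw [mul_assoc r, ← h])
      exact ⟨v * r, by simpa only [mul_assoc] using hv⟩
  refine ⟨hZ, hT, stabR, stabL, fun a ha ha' d hd hd' => ?_⟩
  by_contra! hcon
  let I : Set S := {z | z ∈ T ∧ ∀ u, a * u * z ∈ Z}
  have hI : I = Z ∨ I = T := by
    refine hmin I ⟨Set.subset_univ _, fun z hz t _ => ⟨⟨(hT.2 z hz.1 t trivial).1, fun u => ?_⟩,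
      ⟨(hT.2 z hz.1 t trivial).2, fun u => ?_⟩⟩⟩
      (fun z hz => ⟨hZT hz, fun u => (hZ.2 z hz _ trivial).1⟩) (fun z hz => hz.1)
    · have := hz.2 (u * t)
      simpa only [mul_assoc] using this
    · have := (hZ.2 _ (hz.2 u) t trivial).2
      simpa only [mul_assoc] using this
  have hIT : I = T := hI.resolve_left fun h => hd' (h ▸ (⟨hd, hcon⟩ : d ∈ I))
  have haz : ∀ u, ∀ z ∈ T, a * u * z ∈ Z := fun u z hz => (hIT ▸ hz : z ∈ I).2 u
  let M : Set S := {z | z ∈ T ∧ ∀ u, ∀ z' ∈ T, z * u * z' ∈ Z}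
  have hM : M = Z ∨ M = T := by
    refine hmin M ⟨Set.subset_univ _, fun z hz t _ =>
      ⟨⟨(hT.2 z hz.1 t trivial).1, fun u z' hz' => ?_⟩,
      ⟨(hT.2 z hz.1 t trivial).2, fun u z' hz' => ?_⟩⟩⟩
      (fun z hz => ⟨hZT hz, fun u z' _ => (hZ.2 _ (hZ.2 z hz _ trivial).2 _ trivial).2⟩)
      (fun z hz => hz.1)
    · have := (hZ.2 _ (hz.2 u z' hz') t trivial).1
      simpa only [mul_assoc] using this
    · have := hz.2 (t * u) z' hz'
      simpa only [mul_assoc] using this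
  have hMT : M = T := hM.resolve_left fun h => ha' (h ▸ (⟨ha, haz⟩ : a ∈ M))
  have hbM : b ∈ M := hMT ▸ hb
  obtain ⟨v, hv⟩ := stabR b hb c hbc
  apply hbc
  rw [← hv, mul_assoc b c v]
  exact hbM.2 _ c hc

lemma PrincipalSeries.isIdealIn_succ (ps : PrincipalSeries S) {i : ℕ} (hi : i ≤ ps.m) :
    IsIdealIn Set.univ (ps.C (i + 1)) := by
  rcases hi.lt_or_eq with h | rfl
  · exact ps.ideal _ (by omega) h
  · rw [ps.last]
    exact ⟨Set.subset_univ _, fun a ha => ha.elim⟩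

/-- A non-nilpotent principal factor of a pseudo-nilpotent finite semigroup has no zero divisors
and more than one `H`-class. -/
lemma PrincipalSeries.factor_of_not_setMNMod [Finite S] (hPN : IsPN S) (ps : PrincipalSeries S)
    {i : ℕ} (h1 : 1 ≤ i) (hm : i ≤ ps.m) (hn : ¬ SetMNMod (ps.C (i + 1)) (ps.C i)) :
    IsRegularFactor (ps.C (i + 1)) (ps.C i) ∧
    (∀ a ∈ ps.C i, a ∉ ps.C (i + 1) → ∀ b ∈ ps.C i, b ∉ ps.C (i + 1) → a * b ∉ ps.C (i + 1)) ∧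
    ∃ x ∈ ps.C i \ ps.C (i + 1), ∃ y ∈ ps.C i \ ps.C (i + 1), ¬ (GreenR x y ∧ GreenL x y) := by
  have hZ := ps.isIdealIn_succ hm
  have hT := ps.ideal i h1 hm
  obtain ⟨x, hx, y, hy, w, hw, hne⟩ : ∃ x ∈ ps.C i, ∃ y ∈ ps.C i, ∃ w : ℕ → Option S,
      (∀ k c, w k = some c → c ∈ ps.C i) ∧
      ¬ ReesEq (ps.C (i + 1)) (malcev x y w (Nat.card (S × S) + 2)).1
        (malcev x y w (Nat.card (S × S) + 2)).2 := by
    by_contra! hcon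
    exact hn ⟨_, Nat.succ_pos _, hcon⟩
  have hcol : ∀ n ≤ Nat.card (S × S) + 1,
      ¬ MalcevCollapsed (ps.C (i + 1)) (malcev x y w n) :=
    fun n hn h => hne (h.reesEq_of_lt hZ (by omega))
  have hxy := hcol 0 (Nat.zero_le _)
  simp only [malcev, MalcevCollapsed, not_or] at hxy
  have hF : IsRegularFactor (ps.C (i + 1)) (ps.C i) := by
    have hcol1 := hcol 1 (by omega)
    simp only [malcev, MalcevCollapsed, not_or] at hcol1
    have hprod : mulW x (w 0) y ∉ ps.C (i + 1) := hcol1.1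
    cases hw0 : w 0 with
    | none =>
      rw [hw0] at hprod
      exact isRegularFactor_of_minimal hZ hT (ps.ssub i h1 hm).1 (ps.maximal i h1 hm) hx hy hprod
    | some c =>
      rw [hw0] at hprod
      exact isRegularFactor_of_minimal hZ hT (ps.ssub i h1 hm).1 (ps.maximal i h1 hm)
        (hT.2 x hx c trivial).2 hy hprod
  exact ⟨hF, fun a ha ha' b hb hb' => hF.mul_notMem_of_malcev hPN hx hy hw hcol ha ha' hb hb',
    x, ⟨hx, hxy.1⟩, y, ⟨hy, hxy.2.1⟩,
    hF.not_green_of_malcev hPN hy (fun n hn => hcol n (by omega))⟩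

/-- Elements of the stem do not annihilate any element of the factor. -/
lemma mul_notMem_of_mem_stem {ps : PrincipalSeries S} {i : ℕ}
    (F : IsRegularFactor (ps.C (i + 1)) (ps.C i))
    (hmul : ∀ a ∈ ps.C i, a ∉ ps.C (i + 1) → ∀ b ∈ ps.C i, b ∉ ps.C (i + 1) →
      a * b ∉ ps.C (i + 1))
    {s b : S} (hs : s ∈ Stem ps i) (hb : b ∈ ps.C i) (hb' : b ∉ ps.C (i + 1)) :
    s * b ∉ ps.C (i + 1) ∧ b * s ∉ ps.C (i + 1) := by
  rcases hs with ⟨-, a, ha, h | h⟩ | ⟨hs, hs'⟩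
  · have h1 := hmul b hb hb' _ (F.mul_left_mem ha s) h
    rw [← mul_assoc] at h1
    have hbs := F.left_notMem h1
    have h2 := hmul _ (F.mul_right_mem hb s) hbs b hb hb'
    rw [mul_assoc] at h2
    exact ⟨F.right_notMem h2, hbs⟩
  · have h1 := hmul _ (F.mul_right_mem ha s) h b hb hb'
    rw [mul_assoc] at h1
    have hsb := F.right_notMem h1
    have h2 := hmul b hb hb' _ (F.mul_left_mem hb s) hsb
    rw [← mul_assoc] at h2
    exact ⟨hsb, F.left_notMem h2⟩
  · exact ⟨hmul s hs hs' b hb hb', hmul b hb hb' s hs hs'⟩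

lemma NEdge.symm {a b : S} (h : NEdge a b) : NEdge b a :=
  ⟨h.1.symm, by rw [Set.pair_comm]; exact h.2⟩

lemma PrincipalSeries.stem_path [Finite S] (hPN : IsPN S) (ps : PrincipalSeries S)
    {i : ℕ} (h1 : 1 ≤ i) (hm : i ≤ ps.m) (hroot : Root ps i) {a b : S} (ha : a ∈ Stem ps i)
    (hb : b ∈ Stem ps i) : NEdge a b ∨ ∃ c, NEdge a c ∧ NEdge c b := by
  obtain ⟨F, hmul, c, hc, y, hy, hH⟩ := ps.factor_of_not_setMNMod hPN h1 hm hroot.1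
  have hact : ∀ s ∈ Stem ps i, s * c ∉ ps.C (i + 1) ∧ c * s ∉ ps.C (i + 1) :=
    fun s hs => mul_notMem_of_mem_stem F hmul hs hc.1 hc.2
  have hedge : ∀ s ∈ Stem ps i, ∀ t ∈ Stem ps i,
      ¬ (GreenR (s * c) (t * c) ∧ GreenL (c * s) (c * t)) → NEdge s t := by
    intro s hs t ht h
    have hsc := hact s hs
    have htc := hact t ht
    have hsct := F.chain hc.1 hsc.1 htc.2
    have htcs := F.chain hc.1 htc.1 hsc.2
    refine F.nEdge hPN hmul hc.1 hsc.1 hsc.2 htc.1 htc.2 fun hG => h ⟨?_, ?_⟩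
    · exact (F.greenR_mul (F.mul_left_mem hc.1 s) hsct).symm.trans
        (hG.1.trans (F.greenR_mul (F.mul_left_mem hc.1 t) htcs))
    · rw [mul_assoc] at hsct htcs
      rw [mul_assoc s, mul_assoc t] at hG
      exact (F.greenL_mul (F.mul_right_mem hc.1 s) htcs).symm.trans
        (hG.2.symm.trans (F.greenL_mul (F.mul_right_mem hc.1 t) hsct))
  by_cases hab : GreenR (a * c) (b * c) ∧ GreenL (c * a) (c * b)
  · right
    obtain ⟨d, hd, hd'⟩ : ∃ d ∈ Stem ps i,
        ¬ (GreenR (a * c) (d * c) ∧ GreenL (c * a) (c * d)) := by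
      by_contra! hcon
      have hc1 := hcon c (Or.inr hc)
      have hy1 := hcon y (Or.inr hy)
      have hcc := hmul c hc.1 hc.2 c hc.1 hc.2
      have hcy := hmul c hc.1 hc.2 y hy.1 hy.2
      have hyc := hmul y hy.1 hy.2 c hc.1 hc.2
      exact hH ⟨(F.greenR_mul hc.1 hcc).symm.trans
          (hc1.1.symm.trans (hy1.1.trans (F.greenR_mul hy.1 hyc))),
        (F.greenL_mul hc.1 hcc).symm.trans
          (hc1.2.symm.trans (hy1.2.trans (F.greenL_mul hy.1 hcy)))⟩
    exact ⟨d, hedge a ha d hd hd', (hedge b hb d hd fun h =>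
      hd' ⟨hab.1.trans h.1, hab.2.trans h.2⟩).symm⟩
  · exact Or.inl (hedge a ha b hb hab)

lemma PrincipalSeries.antitone (ps : PrincipalSeries S) {i : ℕ} (hi : 1 ≤ i) (hm : i ≤ ps.m) :
    ps.C ps.m ⊆ ps.C i := by
  induction hm using Nat.decreasingInduction with
  | self => exact subset_rfl
  | of_succ k hk ih => exact (ih (by omega)).trans (ps.ssub k hi hk.le).1

/-- If `K` is empty, the minimal ideal is a root whose stem is everything. -/
lemma PrincipalSeries.exists_stem_eq_univ [Nonempty S] (ps : PrincipalSeries S)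
    (hK : Kset ps = ∅) : ∃ i, 1 ≤ i ∧ i ≤ ps.m ∧ Root ps i ∧ Stem ps i = Set.univ := by
  have hm : 1 ≤ ps.m := by
    by_contra! h
    have h0 : ps.m = 0 := by omega
    have := ps.last
    rw [h0, zero_add, ps.first] at this
    exact Set.univ_nonempty.ne_empty this
  obtain ⟨a, ha, ha'⟩ := Set.exists_of_ssubset (ps.ssub ps.m hm le_rfl)
  refine ⟨ps.m, hm, le_rfl, ?_, ?_⟩
  · by_contra hroot
    have : a ∈ Kset ps := ⟨ps.m, hm, le_rfl, ⟨hroot, fun j hj hjm hsub =>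
      ((hsub ⟨ha, ha'⟩).1 (ps.antitone hj hjm ha)).elim⟩, ha, ha'⟩
    rw [hK] at this
    exact this
  · refine Set.eq_univ_of_forall fun s => ?_
    by_cases hs : s ∈ ps.C ps.m
    · exact Or.inr ⟨hs, by simp [ps.last]⟩
    · exact Or.inl ⟨hs, a, ha, Or.inl (by simp [ps.last])⟩

/-- Every stem is connected in `N_S`, any two distinct elements of a stem being
joined by a path of length at most `2`; if moreover `K = ∅` then `S` is a single
stem, `N_S` is connected, and any two distinct vertices are joined by a path of
length at most `2`. -/
theorem stmt17 {S : Type*} [Semigroup S] [Finite S] [Nonempty S]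
    (hPN : IsPN S) (ps : PrincipalSeries S) :
    (∀ i, 1 ≤ i → i ≤ ps.m → Root ps i →
      ∀ a ∈ Stem ps i, ∀ b ∈ Stem ps i, a ≠ b →
        (NEdge a b ∨ ∃ c, NEdge a c ∧ NEdge c b)) ∧
    (Kset ps = ∅ →
      (∃ i, 1 ≤ i ∧ i ≤ ps.m ∧ Root ps i ∧ Stem ps i = Set.univ) ∧
      (∀ a b : S, a ≠ b → (NEdge a b ∨ ∃ c, NEdge a c ∧ NEdge c b))) := by
  refine ⟨fun i h1 hm hroot a ha b hb _ => ps.stem_path hPN h1 hm hroot ha hb, fun hK => ?_⟩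
  obtain ⟨i, h1, hm, hroot, huniv⟩ := ps.exists_stem_eq_univ hK
  exact ⟨⟨i, h1, hm, hroot, huniv⟩, fun a b _ =>
    ps.stem_path hPN h1 hm hroot (huniv ▸ Set.mem_univ a) (huniv ▸ Set.mem_univ b)⟩
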